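/- Suppose at least one of g, h is injective, that there is no non-trivial x ∈ F(Σ) with u₁·g(x)·u₁⁻¹ = v₁·h(x)·v₁⁻¹, and that there is no non-trivial x ∈ F(Σ) with u₂⁻¹·g(x)·u₂ = v₂⁻¹·h(x)·v₂. Then there exists x ∈ F(Σ) (possibly trivial) with u₁·g(x)·u₂ = v₁·h(x)·v₂ if and only if there exists a non-trivial w ∈ F(Σ') with g'(w) = h'(w). -/

import Mathlib

namespace PCP

/-- The extended source alphabet `Σ' = Σ ⊔ {B, E}`: `Sum.inr false` is `B`, `Sum.inr true` is `E`. -/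
abbrev Sig' (S : Type*) := S ⊕ Bool

/-- The extended target alphabet `Δ' = Δ ⊔ {B, E, #}`:
`Sum.inr 0` is `B`, `Sum.inr 1` is `E`, `Sum.inr 2` is `#`. -/
abbrev Del' (D : Type*) := D ⊕ Fin 3

/-- The generator `B` of `F(Σ')`. -/
def Bs {S : Type*} : FreeGroup (Sig' S) := FreeGroup.of (Sum.inr false)

/-- The generator `E` of `F(Σ')`. -/
def Es {S : Type*} : FreeGroup (Sig' S) := FreeGroup.of (Sum.inr true)

/-- The generator `B` of `F(Δ')`. -/
def Bd {D : Type*} : FreeGroup (Del' D) := FreeGroup.of (Sum.inr 0)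

/-- The generator `E` of `F(Δ')`. -/
def Ed {D : Type*} : FreeGroup (Del' D) := FreeGroup.of (Sum.inr 1)

/-- The generator `#` of `F(Δ')`. -/
def hsh {D : Type*} : FreeGroup (Del' D) := FreeGroup.of (Sum.inr 2)

/-- The inclusion `ιΣ : F(Σ) → F(Σ')`. -/
def incS {S : Type*} : FreeGroup S →* FreeGroup (Sig' S) := FreeGroup.map Sum.inl

/-- The inclusion `ι : F(Δ) → F(Δ')`. -/
def incD {D : Type*} : FreeGroup D →* FreeGroup (Del' D) := FreeGroup.map Sum.inl

/-- The homomorphism `g' : F(Σ') → F(Δ')` associated to `g, u₁, u₂`. -/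
def gMap {S D : Type*} (g : FreeGroup S →* FreeGroup D) (u₁ u₂ : FreeGroup D) :
    FreeGroup (Sig' S) →* FreeGroup (Del' D) :=
  FreeGroup.lift fun z => match z with
    | Sum.inl s => hsh⁻¹ * incD (g (FreeGroup.of s)) * hsh
    | Sum.inr false => Bd * hsh * incD u₁ * hsh
    | Sum.inr true => hsh⁻¹ * incD u₂ * hsh * Ed

/-- The homomorphism `h' : F(Σ') → F(Δ')` associated to `h, v₁, v₂`. -/
def hMap {S D : Type*} (h : FreeGroup S →* FreeGroup D) (v₁ v₂ : FreeGroup D) :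
    FreeGroup (Sig' S) →* FreeGroup (Del' D) :=
  FreeGroup.lift fun z => match z with
    | Sum.inl s => hsh * incD (h (FreeGroup.of s)) * hsh⁻¹
    | Sum.inr false => Bd * hsh * incD v₁ * hsh⁻¹
    | Sum.inr true => hsh * incD v₂ * hsh * Ed

section NormalForms

/-! ### Normal forms in the free product of a group with the free group on `B`, `E` -/

/-- A letter `B^{±1}` or `E^{±1}` (the second component is `true` for exponent `1`) followed by
an element of `K`. -/
abbrev Syllable (K : Type*) := (Bool × Bool) × K

/-- The formal inverse of a letter. -/
def invLetter (t : Bool × Bool) : Bool × Bool := (t.1, !t.2)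

@[simp] lemma invLetter_invLetter (t : Bool × Bool) : invLetter (invLetter t) = t := by
  simp [invLetter]

variable {K : Type*} [Group K]

/-- No letter is separated from its inverse by a trivial element of `K`. -/
def Reduced (L : List (Syllable K)) : Prop :=
  L.IsChain fun p q => p.2 = 1 → q.1 ≠ invLetter p.1

open Classical in
/-- Left multiplication of a normal form by a letter. -/
noncomputable def push (t : Bool × Bool) : K × List (Syllable K) → K × List (Syllable K)
  | (k, []) => (1, [(t, k)])
  | (k, (s, k') :: L) =>
    if k = 1 ∧ s = invLetter t then (k', L) else (1, (t, k) :: (s, k') :: L)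

lemma Reduced.push {f : K × List (Syllable K)} (hf : Reduced f.2) (t : Bool × Bool) :
    Reduced (push t f).2 := by
  obtain ⟨k, _ | ⟨⟨s, k'⟩, L⟩⟩ := f
  · simp [PCP.push, Reduced]
  · by_cases hc : k = 1 ∧ s = invLetter t
    · simp only [PCP.push, if_pos hc]
      exact List.IsChain.tail hf
    · simp only [PCP.push, if_neg hc]
      exact List.isChain_cons_cons.2 ⟨fun h1 h2 => hc ⟨h1, h2⟩, hf⟩

lemma push_invLetter_push {f : K × List (Syllable K)} (hf : Reduced f.2) (t : Bool × Bool) :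
    push (invLetter t) (push t f) = f := by
  obtain ⟨k, _ | ⟨⟨s, k'⟩, L⟩⟩ := f
  · simp [push]
  · by_cases hc : k = 1 ∧ s = invLetter t
    · obtain ⟨rfl, rfl⟩ := hc
      cases L with
      | nil => simp [push]
      | cons p L =>
        have := (List.isChain_cons_cons.1 hf).1
        simp only [invLetter_invLetter] at this
        simpa [push] using fun h1 h2 => (this h1 h2).elim
    · simp [push, hc]

lemma length_push_le (t : Bool × Bool) (f : K × List (Syllable K)) :
    (push t f).2.length ≤ f.2.length + 1 := by
  obtain ⟨k, _ | ⟨⟨s, k'⟩, L⟩⟩ := f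
  · simp [push]
  · by_cases hc : k = 1 ∧ s = invLetter t <;> simp [push, hc]; omega

lemma push_eq_of_length (t : Bool × Bool) (f : K × List (Syllable K))
    (h : (push t f).2.length = f.2.length + 1) : push t f = (1, (t, f.1) :: f.2) := by
  obtain ⟨k, _ | ⟨⟨s, k'⟩, L⟩⟩ := f
  · simp [push]
  · by_cases hc : k = 1 ∧ s = invLetter t
    · simp [push, hc] at h
      omega
    · simp [push, hc]

lemma push_eq_of_reduced (t : Bool × Bool) (k : K) (L : List (Syllable K))
    (h : Reduced ((t, k) :: L)) : push t (k, L) = (1, (t, k) :: L) := by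
  obtain _ | ⟨⟨s, k'⟩, L⟩ := L
  · simp [push]
  · have := (List.isChain_cons_cons.1 h).1
    simpa [push] using fun h1 h2 => (this h1 h2).elim

variable (K) in
/-- Reduced forms `k₀ t₁ k₁ ⋯ tₙ kₙ`. -/
abbrev NormalForm := {f : K × List (Syllable K) // Reduced f.2}

variable (K) in
/-- The normal form of the identity. -/
def NormalForm.one : NormalForm K := ⟨(1, []), List.isChain_nil⟩

/-- The action of a letter on normal forms. -/
noncomputable def pushPerm (t : Bool × Bool) : Equiv.Perm (NormalForm K) where
  toFun f := ⟨push t f.1, f.2.push t⟩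
  invFun f := ⟨push (invLetter t) f.1, f.2.push (invLetter t)⟩
  left_inv f := Subtype.ext (push_invLetter_push f.2 t)
  right_inv f := Subtype.ext (by simpa using push_invLetter_push f.2 (invLetter t))

lemma pushPerm_inv (t : Bool × Bool) :
    (pushPerm t : Equiv.Perm (NormalForm K))⁻¹ = pushPerm (invLetter t) :=
  Equiv.ext fun _ => rfl

/-- The action of `K` on normal forms by left multiplication. -/
def mulLeftPerm : K →* Equiv.Perm (NormalForm K) where
  toFun a :=
    { toFun := fun f => ⟨(a * f.1.1, f.1.2), f.2⟩
      invFun := fun f => ⟨(a⁻¹ * f.1.1, f.1.2), f.2⟩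
      left_inv := fun f => by simp
      right_inv := fun f => by simp }
  map_one' := by ext f <;> simp
  map_mul' a b := by ext f <;> simp [mul_assoc]

/-- The normal form of a possibly non-reduced form. -/
noncomputable def normalize (f : K × List (Syllable K)) : NormalForm K :=
  mulLeftPerm f.1 (f.2.rec (NormalForm.one K) fun p _ r => pushPerm p.1 (mulLeftPerm p.2 r))

lemma normalize_nil (k : K) : normalize (k, []) = mulLeftPerm k (NormalForm.one K) := rfl

lemma normalize_cons (k k' : K) (t : Bool × Bool) (L : List (Syllable K)) :
    normalize (k, (t, k') :: L) = mulLeftPerm k (pushPerm t (normalize (k', L))) := rfl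

lemma normalize_of_reduced (L : List (Syllable K)) (hL : Reduced L) (k : K) :
    (normalize (k, L)).1 = (k, L) := by
  induction L generalizing k with
  | nil => simp [normalize_nil, mulLeftPerm, NormalForm.one]
  | cons p L ih =>
    obtain ⟨t, k'⟩ := p
    simp [normalize_cons, mulLeftPerm, pushPerm, ih (List.IsChain.tail hL),
      push_eq_of_reduced t k' L hL]

lemma length_normalize_le (k : K) (L : List (Syllable K)) :
    (normalize (k, L)).1.2.length ≤ L.length := by
  induction L generalizing k with
  | nil => simp [normalize_nil, mulLeftPerm, NormalForm.one]
  | cons p L ih =>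
    obtain ⟨t, k'⟩ := p
    exact (length_push_le t _).trans (Nat.succ_le_succ (ih k'))

lemma normalize_of_length (k : K) (L : List (Syllable K))
    (h : (normalize (k, L)).1.2.length = L.length) : (normalize (k, L)).1 = (k, L) := by
  induction L generalizing k with
  | nil => simp [normalize_nil, mulLeftPerm, NormalForm.one]
  | cons p L ih =>
    obtain ⟨t, k'⟩ := p
    have h' : (push t (normalize (k', L)).1).2.length = L.length + 1 := h
    have hle := length_push_le t (normalize (k', L)).1
    have hle' := length_normalize_le k' L
    have hlen : (normalize (k', L)).1.2.length = L.length := by omega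
    have hpush := push_eq_of_length t (normalize (k', L)).1 (by omega)
    rw [ih k' hlen] at hpush
    simp [normalize_cons, mulLeftPerm, pushPerm, ih k' hlen, hpush]

end NormalForms

section Words

variable {S : Type*}

/-- The element of `F(Σ')` given by a letter. -/
def letter (t : Bool × Bool) : FreeGroup (Sig' S) :=
  cond t.2 (FreeGroup.of (Sum.inr t.1)) (FreeGroup.of (Sum.inr t.1))⁻¹

lemma letter_invLetter (t : Bool × Bool) :
    (letter (invLetter t) : FreeGroup (Sig' S)) = (letter t)⁻¹ := by
  obtain ⟨b, _ | _⟩ := t <;> simp [letter, invLetter]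

/-- The element of `F(Σ')` represented by a form over `F(Σ)`. -/
def value (f : FreeGroup S × List (Syllable (FreeGroup S))) : FreeGroup (Sig' S) :=
  incS f.1 * f.2.rec 1 fun p _ r => letter p.1 * (incS p.2 * r)

lemma value_nil (k : FreeGroup S) : value (k, []) = incS k := mul_one _

lemma value_cons (k k' : FreeGroup S) (t : Bool × Bool) (L : List (Syllable (FreeGroup S))) :
    value (k, (t, k') :: L) = incS k * (letter t * value (k', L)) := rfl

lemma value_mul_left (a k : FreeGroup S) (L : List (Syllable (FreeGroup S))) :
    value (a * k, L) = incS a * value (k, L) := by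
  simp [value, mul_assoc]

lemma value_push (t : Bool × Bool) (f : FreeGroup S × List (Syllable (FreeGroup S))) :
    value (push t f) = letter t * value f := by
  obtain ⟨k, _ | ⟨⟨s, k'⟩, L⟩⟩ := f
  · simp [push, value_cons]
  · by_cases hc : k = 1 ∧ s = invLetter t
    · simp [push, hc, value_cons, letter_invLetter]
    · simp [push, hc, value_cons]

lemma exists_value_eq_mul (w : FreeGroup (Sig' S)) (f : NormalForm (FreeGroup S)) :
    ∃ f' : NormalForm (FreeGroup S), value f'.1 = w * value f.1 := by
  induction w using FreeGroup.induction_on generalizing f with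
  | C1 => exact ⟨f, by simp⟩
  | of z =>
    obtain s | b := z
    · exact ⟨mulLeftPerm (FreeGroup.of s) f, value_mul_left (FreeGroup.of s) f.1.1 f.1.2⟩
    · exact ⟨pushPerm (b, true) f, value_push _ _⟩
  | inv_of z _ =>
    obtain s | b := z
    · exact ⟨mulLeftPerm (FreeGroup.of s)⁻¹ f, value_mul_left (FreeGroup.of s)⁻¹ f.1.1 f.1.2⟩
    · exact ⟨pushPerm (b, false) f, value_push _ _⟩
  | mul x y hx hy =>
    obtain ⟨f₁, h₁⟩ := hy f
    obtain ⟨f₂, h₂⟩ := hx f₁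
    exact ⟨f₂, by rw [h₂, h₁, mul_assoc]⟩

lemma exists_value_eq (w : FreeGroup (Sig' S)) :
    ∃ f : NormalForm (FreeGroup S), value f.1 = w := by
  obtain ⟨f, hf⟩ := exists_value_eq_mul w (NormalForm.one _)
  exact ⟨f, by simpa [NormalForm.one, value_nil] using hf⟩

end Words

section Transform

variable {S K : Type*} [Group K]

/-- The factor in `K` preceding a letter in its image, where `B ↦ B·a` and `E ↦ b·E`. -/
def leftFactor (a b : K) : Bool × Bool → K
  | (false, true) => 1
  | (false, false) => a⁻¹
  | (true, true) => b
  | (true, false) => 1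

/-- The factor in `K` following a letter in its image. -/
def rightFactor (a b : K) (t : Bool × Bool) : K := (leftFactor a b (invLetter t))⁻¹

/-- The form of `c` times the image of a form under `φ`, `B ↦ B·a`, `E ↦ b·E`. -/
def transform (φ : FreeGroup S →* K) (a b : K) :
    K → FreeGroup S → List (Syllable (FreeGroup S)) → K × List (Syllable K)
  | c, k, [] => (c * φ k, [])
  | c, k, (t, k') :: L =>
    let f := transform φ a b (rightFactor a b t) k' L
    (c * φ k * leftFactor a b t, (t, f.1) :: f.2)

variable (φ : FreeGroup S →* K) (a b : K)

lemma length_transform (c : K) (k : FreeGroup S) (L : List (Syllable (FreeGroup S))) :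
    (transform φ a b c k L).2.length = L.length := by
  induction L generalizing c k with
  | nil => rfl
  | cons p L ih => simp [transform, ih]

lemma reduced_transform (hφ : Function.Injective φ) (c : K) (k : FreeGroup S)
    (L : List (Syllable (FreeGroup S))) (hL : Reduced L) :
    Reduced (transform φ a b c k L).2 := by
  induction L generalizing c k with
  | nil => exact List.isChain_nil
  | cons p L ih =>
    obtain ⟨t, k'⟩ := p
    have ih' := ih (rightFactor a b t) k' (List.IsChain.tail hL)
    cases L with
    | nil => exact List.isChain_singleton _
    | cons q L =>
      obtain ⟨s, k''⟩ := q
      refine List.isChain_cons_cons.2 ⟨?_, ih'⟩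
      intro h1 h2
      dsimp only [transform] at h1 h2
      subst h2
      refine (List.isChain_cons_cons.1 hL).1 (hφ ?_) rfl
      rw [map_one]
      refine conj_eq_one_iff (a := rightFactor a b t) |>.1 ?_
      rwa [rightFactor, inv_inv]

lemma normalize_transform (Φ : FreeGroup (Sig' S) →* Equiv.Perm (NormalForm K))
    (hΦ : ∀ x, Φ (incS x) = mulLeftPerm (φ x))
    (hΦ' : ∀ t, Φ (letter t) =
      mulLeftPerm (leftFactor a b t) * pushPerm t * mulLeftPerm (rightFactor a b t))
    (c : K) (k : FreeGroup S) (L : List (Syllable (FreeGroup S))) :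
    normalize (transform φ a b c k L) =
      mulLeftPerm c (Φ (value (k, L)) (NormalForm.one K)) := by
  induction L generalizing c k with
  | nil => simp [transform, normalize_nil, value_nil, hΦ]
  | cons p L ih =>
    obtain ⟨t, k'⟩ := p
    simp [transform, normalize_cons, value_cons, hΦ, hΦ', ih]

lemma letter_formula (Φ : FreeGroup (Sig' S) →* Equiv.Perm (NormalForm K))
    (hB : Φ Bs = pushPerm (false, true) * mulLeftPerm a)
    (hE : Φ Es = mulLeftPerm b * pushPerm (true, true)) (t : Bool × Bool) :
    Φ (letter t) =
      mulLeftPerm (leftFactor a b t) * pushPerm t * mulLeftPerm (rightFactor a b t) := by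
  have hB' : Φ (FreeGroup.of (Sum.inr false)) = _ := hB
  have hE' : Φ (FreeGroup.of (Sum.inr true)) = _ := hE
  obtain ⟨_ | _, _ | _⟩ := t <;>
    simp [letter, leftFactor, rightFactor, invLetter, hB', hE', pushPerm_inv]

end Transform

section Target

variable {D : Type*}

/-- The action of `F(Δ')` on normal forms in which `B`, `E` act as letters. -/
noncomputable def formAction :
    FreeGroup (Del' D) →* Equiv.Perm (NormalForm (FreeGroup (Del' D))) :=
  FreeGroup.lift fun z => match z with
    | Sum.inl d => mulLeftPerm (FreeGroup.of (Sum.inl d))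
    | Sum.inr 0 => pushPerm (false, true)
    | Sum.inr 1 => pushPerm (true, true)
    | Sum.inr 2 => mulLeftPerm hsh

@[simp] lemma formAction_incD (x : FreeGroup D) :
    formAction (incD x) = mulLeftPerm (incD x) := by
  have : formAction.comp incD = mulLeftPerm.comp (incD (D := D)) := by
    ext1 d
    simp [formAction, incD]
  exact DFunLike.congr_fun this x

@[simp] lemma formAction_hsh : formAction (hsh (D := D)) = mulLeftPerm hsh := by
  simp [formAction, hsh]

@[simp] lemma formAction_Bd : formAction (Bd (D := D)) = pushPerm (false, true) := by
  simp [formAction, Bd]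

@[simp] lemma formAction_Ed : formAction (Ed (D := D)) = pushPerm (true, true) := by
  simp [formAction, Ed]

lemma incD_injective : Function.Injective (incD (D := D)) :=
  FreeGroup.map_injective Sum.inl_injective

/-- The exponent sum of `#`. -/
def hshExp : FreeGroup (Del' D) →* Multiplicative ℤ :=
  FreeGroup.lift fun z => match z with
    | Sum.inr 2 => Multiplicative.ofAdd 1
    | _ => 1

@[simp] lemma hshExp_incD (x : FreeGroup D) : hshExp (incD x) = 1 := by
  have : hshExp.comp (incD (D := D)) = 1 := by
    ext1 d
    simp [hshExp, incD]
  exact DFunLike.congr_fun this x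

@[simp] lemma hshExp_hsh : hshExp (hsh (D := D)) = Multiplicative.ofAdd 1 := by
  simp [hshExp, hsh]

/-- The action of `F(Δ')` on `ℤ × F(Δ)` in which `Δ` acts on the fibre over `0` and `#` shifts. -/
noncomputable def shiftAction : FreeGroup (Del' D) →* Equiv.Perm (ℤ × FreeGroup D) :=
  FreeGroup.lift fun z => match z with
    | Sum.inl d => Equiv.Perm.prodExtendRight 0 (Equiv.mulLeft (FreeGroup.of d))
    | Sum.inr 2 => Equiv.prodCongr (Equiv.addRight 1) (Equiv.refl _)
    | _ => 1

lemma shiftAction_hsh (n : ℤ) (y : FreeGroup D) : shiftAction hsh (n, y) = (n + 1, y) := by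
  simp [shiftAction, hsh]

lemma shiftAction_incD_zero (x y : FreeGroup D) :
    shiftAction (incD x) (0, y) = (0, x * y) := by
  induction x using FreeGroup.induction_on generalizing y with
  | C1 => simp
  | of d => simp [shiftAction, incD]
  | inv_of d ih => rw [map_inv, map_inv, Equiv.Perm.inv_eq_iff_eq, ih, mul_inv_cancel_left]
  | mul x z hx hz => simp [hx, hz, mul_assoc]

lemma shiftAction_incD_of_ne (x y : FreeGroup D) {n : ℤ} (hn : n ≠ 0) :
    shiftAction (incD x) (n, y) = (n, y) := by
  induction x using FreeGroup.induction_on generalizing y with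
  | C1 => simp
  | of d => simpa [shiftAction, incD] using Equiv.Perm.prodExtendRight_apply_ne _ hn _
  | inv_of d ih => rw [map_inv, map_inv, Equiv.Perm.inv_eq_iff_eq, ih]
  | mul x z hx hz => simp [hx, hz]

lemma eq_one_of_hsh_conj_eq {x y : FreeGroup D}
    (h : hsh⁻¹ * incD x * hsh = hsh * incD y * hsh⁻¹) : x = 1 ∧ y = 1 := by
  have h' : incD x * (hsh * hsh) = hsh * hsh * incD y := by
    calc incD x * (hsh * hsh) = hsh * (hsh⁻¹ * incD x * hsh) * hsh := by group
      _ = _ := by rw [h]; group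
  have key : ∀ p, _ := fun p => DFunLike.congr_fun (congrArg shiftAction h') p
  have h0 := key (0, 1)
  have h2 := key (-2, 1)
  simp [shiftAction_hsh, shiftAction_incD_zero, shiftAction_incD_of_ne] at h0 h2
  exact ⟨h2, h0.symm⟩

end Target

section Homs

variable {S D : Type*}

lemma gMap_incS (g : FreeGroup S →* FreeGroup D) (u₁ u₂ : FreeGroup D) (x : FreeGroup S) :
    gMap g u₁ u₂ (incS x) = hsh⁻¹ * incD (g x) * hsh := by
  have : (gMap g u₁ u₂).comp incS = (MulAut.conj hsh⁻¹).toMonoidHom.comp (incD.comp g) := by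
    ext1 s
    simp [gMap, incS]
  simpa using DFunLike.congr_fun this x

lemma hMap_incS (h : FreeGroup S →* FreeGroup D) (v₁ v₂ : FreeGroup D) (x : FreeGroup S) :
    hMap h v₁ v₂ (incS x) = hsh * incD (h x) * hsh⁻¹ := by
  have : (hMap h v₁ v₂).comp incS = (MulAut.conj hsh).toMonoidHom.comp (incD.comp h) := by
    ext1 s
    simp [hMap, incS]
  simpa using DFunLike.congr_fun this x

lemma gMap_Bs (g : FreeGroup S →* FreeGroup D) (u₁ u₂ : FreeGroup D) :
    gMap g u₁ u₂ Bs = Bd * hsh * incD u₁ * hsh := by simp [gMap, Bs]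

lemma gMap_Es (g : FreeGroup S →* FreeGroup D) (u₁ u₂ : FreeGroup D) :
    gMap g u₁ u₂ Es = hsh⁻¹ * incD u₂ * hsh * Ed := by simp [gMap, Es]

lemma hMap_Bs (h : FreeGroup S →* FreeGroup D) (v₁ v₂ : FreeGroup D) :
    hMap h v₁ v₂ Bs = Bd * hsh * incD v₁ * hsh⁻¹ := by simp [hMap, Bs]

lemma hMap_Es (h : FreeGroup S →* FreeGroup D) (v₁ v₂ : FreeGroup D) :
    hMap h v₁ v₂ Es = hsh * incD v₂ * hsh * Ed := by simp [hMap, Es]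

/-- The segment map `x ↦ #⁻¹·ι(g(x))·#`. -/
def gSeg (g : FreeGroup S →* FreeGroup D) : FreeGroup S →* FreeGroup (Del' D) :=
  (MulAut.conj hsh⁻¹).toMonoidHom.comp (incD.comp g)

/-- The segment map `x ↦ #·ι(h(x))·#⁻¹`. -/
def hSeg (h : FreeGroup S →* FreeGroup D) : FreeGroup S →* FreeGroup (Del' D) :=
  (MulAut.conj hsh).toMonoidHom.comp (incD.comp h)

lemma gSeg_apply (g : FreeGroup S →* FreeGroup D) (x : FreeGroup S) :
    gSeg g x = hsh⁻¹ * incD (g x) * hsh := by simp [gSeg]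

lemma hSeg_apply (h : FreeGroup S →* FreeGroup D) (x : FreeGroup S) :
    hSeg h x = hsh * incD (h x) * hsh⁻¹ := by simp [hSeg]

lemma transform_eq_transform (g h : FreeGroup S →* FreeGroup D) (u₁ u₂ v₁ v₂ : FreeGroup D)
    (hinj : Function.Injective g ∨ Function.Injective h)
    (k : FreeGroup S) (L : List (Syllable (FreeGroup S))) (hL : Reduced L)
    (heq : gMap g u₁ u₂ (value (k, L)) = hMap h v₁ v₂ (value (k, L))) :
    transform (gSeg g) (hsh * incD u₁ * hsh) (hsh⁻¹ * incD u₂ * hsh) 1 k L =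
      transform (hSeg h) (hsh * incD v₁ * hsh⁻¹) (hsh * incD v₂ * hsh) 1 k L := by
  set fg := transform (gSeg g) (hsh * incD u₁ * hsh) (hsh⁻¹ * incD u₂ * hsh) 1 k L with hfg
  set fh := transform (hSeg h) (hsh * incD v₁ * hsh⁻¹) (hsh * incD v₂ * hsh) 1 k L with hfh
  have hng : normalize fg = formAction (gMap g u₁ u₂ (value (k, L))) (NormalForm.one _) := by
    simpa using normalize_transform (gSeg g) _ _ (formAction.comp (gMap g u₁ u₂))
      (fun x => by simp [gMap_incS, gSeg_apply])
      (letter_formula _ _ _ (by simp [gMap_Bs, mul_assoc]) (by simp [gMap_Es])) 1 k L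
  have hnh : normalize fh = formAction (hMap h v₁ v₂ (value (k, L))) (NormalForm.one _) := by
    simpa using normalize_transform (hSeg h) _ _ (formAction.comp (hMap h v₁ v₂))
      (fun x => by simp [hMap_incS, hSeg_apply])
      (letter_formula _ _ _ (by simp [hMap_Bs, mul_assoc]) (by simp [hMap_Es])) 1 k L
  have hn : normalize fg = normalize fh := by rw [hng, hnh, heq]
  have hlen : fg.2.length = fh.2.length := by simp [hfg, hfh, length_transform]
  rcases hinj with hi | hi
  · have e : (normalize fg).1 = fg := normalize_of_reduced _ (reduced_transform _ _ _
      ((MulAut.conj _).injective.comp (incD_injective.comp hi)) _ _ _ hL) _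
    have e' : (normalize fh).1 = fh := normalize_of_length fh.1 fh.2 (by
      change (normalize fh).1.2.length = _
      rw [← hlen, ← hn, e])
    rw [← e, ← e', hn]
  · have e : (normalize fh).1 = fh := normalize_of_reduced _ (reduced_transform _ _ _
      ((MulAut.conj _).injective.comp (incD_injective.comp hi)) _ _ _ hL) _
    have e' : (normalize fg).1 = fg := normalize_of_length fg.1 fg.2 (by
      change (normalize fg).1.2.length = _
      rw [hlen, hn, e])
    rw [← e, ← e', hn]

end Homs

end PCP


open PCP in
/-- If at least one of `g, h` is injective and the instance has no solutions of the two
degenerate conjugacy forms, then the GPCP instance has a (possibly trivial) solution iff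
the associated PCP instance has a non-trivial solution. -/
theorem gpcp_iff_pcp {S D : Type*}
    (g h : FreeGroup S →* FreeGroup D) (u₁ u₂ v₁ v₂ : FreeGroup D)
    (hinj : Function.Injective g ∨ Function.Injective h)
    (h1 : ¬ ∃ x : FreeGroup S, x ≠ 1 ∧ u₁ * g x * u₁⁻¹ = v₁ * h x * v₁⁻¹)
    (h2 : ¬ ∃ x : FreeGroup S, x ≠ 1 ∧ u₂⁻¹ * g x * u₂ = v₂⁻¹ * h x * v₂) :
    (∃ x : FreeGroup S, u₁ * g x * u₂ = v₁ * h x * v₂) ↔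
    (∃ w : FreeGroup (Sig' S), w ≠ 1 ∧ gMap g u₁ u₂ w = hMap h v₁ v₂ w) := by
  constructor
  · rintro ⟨x, hx⟩
    refine ⟨Bs * incS x * Es, fun hw => ?_, ?_⟩
    · set ψ : FreeGroup (Sig' S) →* Multiplicative ℤ :=
        FreeGroup.lift (Sum.elim 1 fun _ => Multiplicative.ofAdd 1) with hψ
      have hinc : ψ.comp incS = 1 := by
        ext1 s
        simp [hψ, incS]
      have hx' : ψ (incS x) = 1 := DFunLike.congr_fun hinc x
      have := congrArg (fun y => (ψ y).toAdd) hw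
      simp [hx'] at this
      simp [hψ, Bs, Es] at this
    · have hx' := congrArg (incD (D := D)) hx
      simp only [map_mul] at hx'
      simp only [map_mul, gMap_incS, hMap_incS, gMap_Bs, hMap_Bs, gMap_Es, hMap_Es]
      calc _ = Bd * hsh * (incD u₁ * incD (g x) * incD u₂) * hsh * Ed := by group
        _ = _ := by rw [hx']; group
  · rintro ⟨w, hw, heq⟩
    obtain ⟨⟨⟨k, L⟩, hL⟩, rfl⟩ := exists_value_eq w
    have hT := transform_eq_transform g h u₁ u₂ v₁ v₂ hinj k L hL heq
    obtain _ | ⟨⟨t, k₁⟩, L⟩ := L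
    · exfalso
      simp only [transform, Prod.mk.injEq, gSeg_apply, hSeg_apply, one_mul, and_true] at hT
      obtain ⟨hg, hh⟩ := eq_one_of_hsh_conj_eq hT
      have : k = 1 := hinj.elim (fun hi => hi (by simpa using hg)) fun hi => hi (by simpa using hh)
      exact hw (by simp [this, value_nil])
    · simp only [transform, Prod.mk.injEq, List.cons.injEq, true_and] at hT
      obtain ⟨hT₀, hT₁, -⟩ := hT
      have hexp₀ := congrArg (fun y => (hshExp y).toAdd) hT₀
      have hexp₁ := congrArg (fun y => (hshExp y).toAdd) hT₁
      obtain _ | ⟨⟨s, k₂⟩, L⟩ := L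
      · obtain ⟨_ | _, _ | _⟩ := t <;>
          simp [transform, leftFactor, rightFactor, invLetter, gSeg_apply, hSeg_apply] at hexp₀ hexp₁
      · have hred := (List.isChain_cons_cons.1 hL).1
        simp only [transform] at hT₁
        obtain ⟨_ | _, _ | _⟩ := t <;> obtain ⟨_ | _, _ | _⟩ := s <;>
          simp [transform, leftFactor, rightFactor, invLetter, gSeg_apply, hSeg_apply]
            at hexp₀ hexp₁ hT₁ hred
        · refine (h1 ⟨k₁, hred, incD_injective
            (mul_left_cancel (a := hsh) (mul_right_cancel (b := hsh⁻¹) ?_))⟩).elim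
          simpa [mul_assoc] using hT₁
        · refine ⟨k₁, incD_injective (mul_left_cancel (a := hsh) (mul_right_cancel (b := hsh) ?_))⟩
          simpa [mul_assoc] using hT₁
        · refine ⟨k₁⁻¹, inv_injective (incD_injective
            (mul_left_cancel (a := hsh⁻¹) (mul_right_cancel (b := hsh⁻¹) ?_)))⟩
          simpa [mul_assoc] using hT₁
        · refine (h2 ⟨k₁, hred, incD_injective
            (mul_left_cancel (a := hsh⁻¹) (mul_right_cancel (b := hsh) ?_))⟩).elim
          simpa [mul_assoc] using hT₁
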